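/- Let M ≥ 1 be an integer, τ > 0, λ ∈ (0,1). For r̃ ∈ ℂ^M define m(r̃) = (1−λ)·φ_{τ²}^{(M)}(r̃) + λ·∫_{ℂ^M} q_M(r)·φ_{τ²}^{(M)}(r̃−r) dr, the M×M matrices S(r̃) = λ·∫_{ℂ^M} r·r*·q_M(r)·φ_{τ²}^{(M)}(r̃−r) dr and B(r̃) = λ·∫_{ℂ^M} r·q_M(r)·φ_{τ²}^{(M)}(r̃−r) dr (r a column vector, r* its conjugate transpose). Then the integrated posterior covariance is a scalar multiple of the identity: ∫_{ℂ^M} (S(r̃) − B(r̃)·B(r̃)*/m(r̃)) dr̃ = MSE·I_M, where MSE = ∫₀^∞ a·λ·g^{2−γ}·τ²·Q(g)/(g²+τ²) dg + ∫₀^∞ (λ·a·s^M/Γ(M+1))·(μ_M(s) − ν_M(s)²/ξ_M(s)) ds, and Γ is the Gamma function. -/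

import Mathlib

open MeasureTheory Set
open scoped ENNReal

noncomputable section

/-- `Q(g) = ∫_{b ln g + c}^∞ exp(-s²) ds`. -/
def Qfun (b c g : ℝ) : ℝ := ∫ s in Set.Ioi (b * Real.log g + c), Real.exp (-s ^ 2)

/-- Squared Euclidean norm on `ℂ^M ≅ ℝ^{2M}`. -/
def nsq {M : ℕ} (r : Fin M → ℂ) : ℝ := ∑ i, ‖r i‖ ^ 2

/-- Circularly symmetric complex Gaussian density of variance `v` on `ℂ^M ≅ ℝ^{2M}`:
`φ_v^{(M)}(r) = (πv)^{-M} exp(-‖r‖²/v)`. -/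
def vgauss (M : ℕ) (v : ℝ) (r : Fin M → ℂ) : ℝ :=
  ((Real.pi * v) ^ M)⁻¹ * Real.exp (-nsq r / v)

/-- Channel-row density `q_M(r) = a π^{-M} ∫₀^∞ g^{-γ-2M} Q(g) exp(-‖r‖²/g²) dg`. -/
def qM (a γ b c : ℝ) (M : ℕ) (r : Fin M → ℂ) : ℝ :=
  a / Real.pi ^ M *
    ∫ g in Set.Ioi (0 : ℝ), g ^ (-γ - 2 * (M : ℝ)) * Qfun b c g * Real.exp (-nsq r / g ^ 2)

attribute [local instance] Matrix.normedAddCommGroup Matrix.normedSpace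

/-- `ν_i(s) = ∫₀^∞ g^{2-γ} Q(g) (g²+τ²)^{-(i+1)} exp(-s/(g²+τ²)) dg`. -/
def nufun (γ b c τ : ℝ) (i : ℕ) (s : ℝ) : ℝ :=
  ∫ g in Set.Ioi (0 : ℝ),
    g ^ (2 - γ) * Qfun b c g / (g ^ 2 + τ ^ 2) ^ (i + 1) * Real.exp (-s / (g ^ 2 + τ ^ 2))

/-- `ξ_i(s) = ((1-λ)/(λ a τ^{2i})) exp(-s/τ²) + ∫₀^∞ g^{-γ} Q(g) (g²+τ²)^{-i} exp(-s/(g²+τ²)) dg`. -/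
def xifun (a γ b c τ lam : ℝ) (i : ℕ) (s : ℝ) : ℝ :=
  (1 - lam) / (lam * a * τ ^ (2 * i)) * Real.exp (-s / τ ^ 2) +
    ∫ g in Set.Ioi (0 : ℝ),
      g ^ (-γ) * Qfun b c g / (g ^ 2 + τ ^ 2) ^ i * Real.exp (-s / (g ^ 2 + τ ^ 2))

/-- `μ_i(s) = ∫₀^∞ g^{4-γ} Q(g) (g²+τ²)^{-(i+2)} exp(-s/(g²+τ²)) dg`. -/
def mufun (γ b c τ : ℝ) (i : ℕ) (s : ℝ) : ℝ :=
  ∫ g in Set.Ioi (0 : ℝ),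
    g ^ (4 - γ) * Qfun b c g / (g ^ 2 + τ ^ 2) ^ (i + 2) * Real.exp (-s / (g ^ 2 + τ ^ 2))
lemma nsq_nonneg {M : ℕ} (r : Fin M → ℂ) : 0 ≤ nsq r :=
  Finset.sum_nonneg fun _ _ => by positivity

lemma continuous_nsq {M : ℕ} : Continuous (nsq : (Fin M → ℂ) → ℝ) := by
  unfold nsq; fun_prop

lemma integral_nsq_gaussian {M : ℕ} {v : ℝ} (hv : 0 < v) :
    ∫ r : Fin M → ℂ, Real.exp (-nsq r / v) = (Real.pi * v) ^ M := by
  have h : ∀ r : Fin M → ℂ, Real.exp (-nsq r / v) = ∏ i, Real.exp (-v⁻¹ * ‖r i‖ ^ 2) := by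
    intro r
    rw [← Real.exp_sum, nsq, ← Finset.mul_sum]
    ring_nf
  simp_rw [h]
  rw [integral_fintype_prod_volume_eq_pow (fun z : ℂ => Real.exp (-v⁻¹ * ‖z‖ ^ 2)),
    GaussianFourier.integral_rexp_neg_mul_sq_norm (inv_pos.2 hv)]
  simp

lemma integrable_nsq_gaussian {M : ℕ} {v : ℝ} (hv : 0 < v) :
    Integrable fun r : Fin M → ℂ => Real.exp (-nsq r / v) :=
  Integrable.of_integral_ne_zero (by
    rw [integral_nsq_gaussian hv]; have := Real.pi_pos; positivity)

lemma integrable_one_add_nsq_mul_gaussian {M : ℕ} {v : ℝ} (hv : 0 < v) :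
    Integrable fun r : Fin M → ℂ => (1 + nsq r) * Real.exp (-nsq r / v) := by
  refine ((integrable_nsq_gaussian (M := M) hv).add
    ((integrable_nsq_gaussian (M := M) (v := 2 * v) (by positivity)).const_mul (2 * v))).mono'
    ?_ (.of_forall fun r => ?_)
  · have := continuous_nsq (M := M)
    exact Continuous.aestronglyMeasurable (by fun_prop)
  · have h0 := nsq_nonneg r
    have h1 : nsq r / (2 * v) ≤ Real.exp (nsq r / (2 * v)) := by
      linarith [Real.add_one_le_exp (nsq r / (2 * v))]
    have h2 : Real.exp (-nsq r / v) =
        Real.exp (-nsq r / (2 * v)) * Real.exp (-nsq r / (2 * v)) := by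
      rw [← Real.exp_add]; congr 1; field_simp; ring
    have h3 : Real.exp (nsq r / (2 * v)) * Real.exp (-nsq r / (2 * v)) = 1 := by
      rw [← Real.exp_add, neg_div, add_neg_cancel, Real.exp_zero]
    rw [Real.norm_of_nonneg (by positivity), Pi.add_apply, add_mul, one_mul]
    refine add_le_add le_rfl ?_
    have h4 : nsq r ≤ 2 * v * Real.exp (nsq r / (2 * v)) := by
      rwa [div_le_iff₀' (by positivity)] at h1
    calc nsq r * Real.exp (-nsq r / v)
        ≤ 2 * v * Real.exp (nsq r / (2 * v)) * Real.exp (-nsq r / v) := by gcongr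
      _ = 2 * v * (Real.exp (nsq r / (2 * v)) * Real.exp (-nsq r / (2 * v))) *
          Real.exp (-nsq r / (2 * v)) := by rw [h2]; ring
      _ = _ := by rw [h3, mul_one]

lemma exists_integral_comp_nsq {M : ℕ} (hM : 1 ≤ M) :
    ∃ C : ℝ, ∀ F : ℝ → ℝ,
      ∫ r : Fin M → ℂ, F (nsq r) = C * ∫ s in Ioi (0 : ℝ), s ^ (M - 1) * F s := by
  have : Nonempty (Fin M) := ⟨⟨0, hM⟩⟩
  let e : EuclideanSpace ℂ (Fin M) ≃L[ℝ] (Fin M → ℂ) :=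
    (PiLp.continuousLinearEquiv 2 ℝ (fun _ : Fin M => ℂ))
  let ν : Measure (EuclideanSpace ℂ (Fin M)) := (volume : Measure (Fin M → ℂ)).map e.symm
  have : ν.IsAddHaarMeasure := e.symm.isAddHaarMeasure_map volume
  have hd : Module.finrank ℝ (EuclideanSpace ℂ (Fin M)) = 2 * M := by
    rw [e.toLinearEquiv.finrank_eq, Module.finrank_pi_fintype]
    simp [mul_comm]
  refine ⟨M * ν.real (Metric.ball 0 1), fun F => ?_⟩
  have h1 := integral_fun_norm_addHaar ν (fun x => F (x ^ 2))
  have h2 : ∫ x, F (‖x‖ ^ 2) ∂ν = ∫ r : Fin M → ℂ, F (nsq r) := by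
    have hemb : MeasurableEmbedding e.symm := e.symm.toHomeomorph.measurableEmbedding
    rw [hemb.integral_map]
    refine integral_congr_ae (.of_forall fun r => ?_)
    change F (‖e.symm r‖ ^ 2) = F (nsq r)
    rw [EuclideanSpace.norm_sq_eq]
    rfl
  rw [← h2, h1, hd, ← integral_comp_rpow_Ioi_of_pos (g := fun s => s ^ (M - 1) * F s) (p := 2) two_pos]
  have h3 : ∫ x in Ioi (0 : ℝ), (2 * x ^ ((2 : ℝ) - 1)) •
        ((x ^ (2 : ℝ)) ^ (M - 1) * F (x ^ (2 : ℝ))) =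
      ∫ x in Ioi (0 : ℝ), 2 * (x ^ (2 * M - 1) • F (x ^ 2)) := by
    refine integral_congr_ae (.of_forall fun x => ?_)
    obtain ⟨k, rfl⟩ := Nat.exists_eq_add_of_le' hM
    have : 2 * (k + 1) - 1 = 2 * k + 1 := by omega
    simp only [smul_eq_mul, this, Real.rpow_two, Nat.add_sub_cancel]
    norm_num
    ring
  rw [h3, integral_const_mul]
  simp only [smul_eq_mul, nsmul_eq_mul, Nat.cast_mul, Nat.cast_ofNat]
  ring

lemma integral_pow_mul_exp_neg_div (n : ℕ) {v : ℝ} (hv : 0 < v) :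
    ∫ s in Ioi (0 : ℝ), s ^ n * Real.exp (-s / v) = v ^ (n + 1) * n.factorial := by
  have h := Real.integral_rpow_mul_exp_neg_mul_Ioi (a := n + 1) (r := v⁻¹)
    (by positivity) (inv_pos.2 hv)
  rw [Real.Gamma_nat_eq_factorial, one_div, inv_inv] at h
  rw [← Nat.cast_succ, Real.rpow_natCast] at h
  rw [← h]
  refine setIntegral_congr_fun measurableSet_Ioi fun s _ => ?_
  simp only [Nat.cast_succ, add_sub_cancel_right, Real.rpow_natCast]
  congr 2
  ring

lemma integral_comp_nsq {M : ℕ} (hM : 1 ≤ M) (F : ℝ → ℝ) :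
    ∫ r : Fin M → ℂ, F (nsq r) =
      Real.pi ^ M / (M - 1).factorial * ∫ s in Ioi (0 : ℝ), s ^ (M - 1) * F s := by
  obtain ⟨C, hC⟩ := exists_integral_comp_nsq hM
  have h := hC fun s => Real.exp (-s / 1)
  rw [integral_nsq_gaussian one_pos, integral_pow_mul_exp_neg_div _ one_pos] at h
  rw [hC]
  congr 1
  rw [eq_div_iff (by positivity)]
  simpa using h.symm

lemma norm_sq_le_nsq {M : ℕ} (r : Fin M → ℂ) (i : Fin M) : ‖r i‖ ^ 2 ≤ nsq r :=
  Finset.single_le_sum (f := fun i => ‖r i‖ ^ 2) (fun _ _ => by positivity) (Finset.mem_univ i)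

lemma norm_mul_star_le_nsq {M : ℕ} (r : Fin M → ℂ) (i j : Fin M) :
    ‖r i * star (r j)‖ ≤ nsq r := by
  rw [norm_mul, norm_star]
  nlinarith [norm_sq_le_nsq r i, norm_sq_le_nsq r j, sq_nonneg (‖r i‖ - ‖r j‖)]

lemma norm_le_one_add_nsq {M : ℕ} (r : Fin M → ℂ) (i : Fin M) : ‖r i‖ ≤ 1 + nsq r := by
  nlinarith [norm_sq_le_nsq r i, sq_nonneg (‖r i‖ - 1), nsq_nonneg r]

lemma integrable_comp_nsq_mul_outer {M : ℕ} {F : ℝ → ℝ} (hFm : Measurable F)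
    (hF : Integrable fun r : Fin M → ℂ => F (nsq r) * nsq r) (i j : Fin M) :
    Integrable fun r : Fin M → ℂ => (F (nsq r) : ℂ) * (r i * star (r j)) := by
  refine hF.norm.mono' ?_ (.of_forall fun r => ?_)
  · have := (continuous_nsq (M := M)).measurable
    have h1 : Measurable fun r : Fin M → ℂ => (F (nsq r) : ℂ) :=
      Complex.measurable_ofReal.comp (hFm.comp this)
    refine (h1.mul ?_).aestronglyMeasurable
    exact Continuous.measurable (by fun_prop)
  · rw [norm_mul, Complex.norm_real, norm_mul (F _), Real.norm_of_nonneg (nsq_nonneg r)]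
    exact mul_le_mul_of_nonneg_left (norm_mul_star_le_nsq r i j) (norm_nonneg _)

lemma integral_comp_nsq_mul_outer_of_ne {M : ℕ} (F : ℝ → ℝ) {i j : Fin M} (hij : i ≠ j) :
    ∫ r : Fin M → ℂ, (F (nsq r) : ℂ) * (r i * star (r j)) = 0 := by
  have hp : ∀ k, MeasurePreserving (fun z : ℂ => if k = i then -z else z) volume volume := by
    intro k
    by_cases hk : k = i
    · simp only [hk, if_true]
      exact Measure.measurePreserving_neg volume
    · simp only [hk, if_false]
      exact MeasurePreserving.id volume
  have hpi := volume_preserving_pi hp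
  have hemb : MeasurableEmbedding
      (fun (r : Fin M → ℂ) k => if k = i then -(r k) else r k) := by
    have hc : Continuous (fun (r : Fin M → ℂ) k => if k = i then -(r k) else r k) := by
      refine continuous_pi fun k => ?_
      split_ifs <;> fun_prop
    refine hc.measurableEmbedding fun x y h => ?_
    funext k
    have := congrFun h k
    by_cases hk : k = i <;> simpa [hk] using this
  have h := hpi.integral_comp hemb (fun r : Fin M → ℂ => (F (nsq r) : ℂ) * (r i * star (r j)))
  have hn : ∀ r : Fin M → ℂ, nsq (fun k => if k = i then -(r k) else r k) = nsq r := by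
    intro r
    refine Finset.sum_congr rfl fun k _ => ?_
    by_cases hk : k = i <;> simp [hk]
  simp only [hn, if_true, hij.symm, if_false, neg_mul, mul_neg, integral_neg] at h
  exact self_eq_neg.1 h.symm

lemma integral_comp_nsq_mul_norm_sq {M : ℕ} (F : ℝ → ℝ) (i j : Fin M) :
    ∫ r : Fin M → ℂ, F (nsq r) * ‖r i‖ ^ 2 = ∫ r : Fin M → ℂ, F (nsq r) * ‖r j‖ ^ 2 := by
  let σ := Equiv.swap i j
  have h := (volume_measurePreserving_piCongrLeft (fun _ : Fin M => ℂ) σ).integral_comp'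
    (fun r : Fin M → ℂ => F (nsq r) * ‖r j‖ ^ 2)
  rw [← h]
  refine integral_congr_ae (.of_forall fun r => ?_)
  have hval : ∀ k, MeasurableEquiv.piCongrLeft (fun _ : Fin M => ℂ) σ r (σ k) = r k := fun k => by
    rw [MeasurableEquiv.coe_piCongrLeft, Equiv.piCongrLeft_apply_apply]
  have hn : nsq (MeasurableEquiv.piCongrLeft (fun _ : Fin M => ℂ) σ r) = nsq r := by
    rw [nsq, ← Equiv.sum_comp σ]
    simp only [hval, nsq]
  have hj : MeasurableEquiv.piCongrLeft (fun _ : Fin M => ℂ) σ r j = r i := by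
    rw [← hval i, Equiv.swap_apply_left]
  simp only [hn, hj]

lemma integral_comp_nsq_mul_outer {M : ℕ} {F : ℝ → ℝ} (hFm : Measurable F)
    (hF : Integrable fun r : Fin M → ℂ => F (nsq r) * nsq r) (i j : Fin M) :
    ∫ r : Fin M → ℂ, (F (nsq r) : ℂ) * (r i * star (r j)) =
      if i = j then
        ((Real.pi ^ M / M.factorial * ∫ s in Ioi (0 : ℝ), s ^ M * F s : ℝ) : ℂ) else 0 := by
  by_cases hij : i = j
  swap
  · rw [if_neg hij, integral_comp_nsq_mul_outer_of_ne F hij]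
  subst hij
  have hM : 1 ≤ M := i.pos
  have hnm : ∀ (r : Fin M → ℂ) (k : Fin M), (F (nsq r) : ℂ) * (r k * star (r k)) =
      ((F (nsq r) * ‖r k‖ ^ 2 : ℝ) : ℂ) := by
    intro r k
    rw [Complex.star_def, Complex.mul_conj, Complex.normSq_eq_norm_sq]
    push_cast
    ring
  have hint : ∀ k : Fin M, Integrable fun r : Fin M → ℂ => F (nsq r) * ‖r k‖ ^ 2 := by
    intro k
    have h := (integrable_comp_nsq_mul_outer hFm hF k k).re
    simpa only [hnm, RCLike.ofReal_re_ax, Complex.ofReal_re, RCLike.re_to_complex] using h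
  rw [if_pos rfl]
  simp_rw [hnm]
  rw [integral_complex_ofReal]
  congr 1
  have h1 : (M : ℝ) * ∫ r : Fin M → ℂ, F (nsq r) * ‖r i‖ ^ 2 =
      ∫ r : Fin M → ℂ, F (nsq r) * nsq r := by
    have hs : ∀ r : Fin M → ℂ, F (nsq r) * nsq r = ∑ k, F (nsq r) * ‖r k‖ ^ 2 := fun r => by
      rw [← Finset.mul_sum, nsq]
    simp_rw [hs]
    rw [integral_finsetSum _ fun k _ => hint k,
      Finset.sum_congr rfl fun k _ => integral_comp_nsq_mul_norm_sq F k i]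
    simp
  rw [integral_comp_nsq hM fun s => F s * s] at h1
  have hM0 : (M : ℝ) ≠ 0 := by positivity
  have h2 : ∫ s in Ioi (0 : ℝ), s ^ (M - 1) * (F s * s) = ∫ s in Ioi (0 : ℝ), s ^ M * F s := by
    obtain ⟨k, rfl⟩ := Nat.exists_eq_add_of_le' hM
    refine integral_congr_ae (.of_forall fun s => ?_)
    simp only [Nat.add_sub_cancel]
    ring
  rw [h2] at h1
  have h3 : ((M.factorial : ℕ) : ℝ) = M * (M - 1).factorial := by
    rw [← Nat.mul_factorial_pred (by omega)]; push_cast; ring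
  rw [h3, ← mul_right_inj' hM0, h1]
  field_simp

lemma nsq_neg {M : ℕ} (r : Fin M → ℂ) : nsq (-r) = nsq r := by
  simp [nsq]

lemma integral_comp_nsq_mul_apply {M : ℕ} (F : ℝ → ℝ) (i : Fin M) :
    ∫ r : Fin M → ℂ, (F (nsq r) : ℂ) * r i = 0 := by
  have h := integral_neg_eq_self (fun r : Fin M → ℂ => (F (nsq r) : ℂ) * r i) volume
  simp only [nsq_neg, Pi.neg_apply, mul_neg, integral_neg] at h
  exact self_eq_neg.1 h.symm

lemma continuous_vgauss (M : ℕ) (v : ℝ) : Continuous (vgauss M v) := by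
  have := continuous_nsq (M := M)
  unfold vgauss
  fun_prop

lemma vgauss_nonneg (M : ℕ) {v : ℝ} (hv : 0 < v) (r : Fin M → ℂ) : 0 ≤ vgauss M v r := by
  have := Real.pi_pos
  unfold vgauss
  positivity

lemma integral_vgauss (M : ℕ) {v : ℝ} (hv : 0 < v) : ∫ r, vgauss M v r = 1 := by
  have := Real.pi_pos
  simp only [vgauss]
  rw [integral_const_mul, integral_nsq_gaussian hv]
  exact inv_mul_cancel₀ (by positivity)

lemma integrable_vgauss (M : ℕ) {v : ℝ} (hv : 0 < v) : Integrable (vgauss M v) :=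
  (integrable_nsq_gaussian hv).const_mul _

lemma integrable_one_add_nsq_mul_vgauss (M : ℕ) {v : ℝ} (hv : 0 < v) :
    Integrable fun r : Fin M → ℂ => (1 + nsq r) * vgauss M v r := by
  refine ((integrable_one_add_nsq_mul_gaussian (M := M) hv).const_mul
    ((Real.pi * v) ^ M)⁻¹).congr (.of_forall fun r => ?_)
  simp only [vgauss]
  ring

lemma integrable_vgauss_mul (M : ℕ) {v : ℝ} (hv : 0 < v) {X : (Fin M → ℂ) → ℂ}
    (hX : Continuous X) (hXb : ∀ r, ‖X r‖ ≤ 1 + nsq r) :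
    Integrable fun r : Fin M → ℂ => (vgauss M v r : ℂ) * X r := by
  have := continuous_vgauss M v
  refine (integrable_one_add_nsq_mul_vgauss M hv).mono'
    (Continuous.aestronglyMeasurable (by fun_prop)) (.of_forall fun r => ?_)
  rw [norm_mul, Complex.norm_real, Real.norm_of_nonneg (vgauss_nonneg M hv r), mul_comm]
  exact mul_le_mul_of_nonneg_right (hXb r) (vgauss_nonneg M hv r)

lemma integral_vgauss_mul_outer (M : ℕ) {v : ℝ} (hv : 0 < v) (i j : Fin M) :
    ∫ r : Fin M → ℂ, (vgauss M v r : ℂ) * (r i * star (r j)) = if i = j then (v : ℂ) else 0 := by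
  have hπ := Real.pi_pos
  have h := integral_comp_nsq_mul_outer (M := M)
    (F := fun s => ((Real.pi * v) ^ M)⁻¹ * Real.exp (-s / v)) (by fun_prop) ?_ i j
  · refine h.trans (if_congr Iff.rfl ?_ rfl)
    congr 1
    have h2 : ∀ s : ℝ, s ^ M * (((Real.pi * v) ^ M)⁻¹ * Real.exp (-s / v)) =
        ((Real.pi * v) ^ M)⁻¹ * (s ^ M * Real.exp (-s / v)) := fun s => by ring
    simp_rw [h2]
    rw [integral_const_mul, integral_pow_mul_exp_neg_div M hv, mul_pow]
    field_simp
    ring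
  · refine ((integrable_one_add_nsq_mul_vgauss M hv).sub (integrable_vgauss M hv)).congr
      (.of_forall fun r => ?_)
    simp only [vgauss, Pi.sub_apply]
    ring

lemma integral_vgauss_mul_apply (M : ℕ) (v : ℝ) (i : Fin M) :
    ∫ r : Fin M → ℂ, (vgauss M v r : ℂ) * r i = 0 :=
  integral_comp_nsq_mul_apply (fun s => ((Real.pi * v) ^ M)⁻¹ * Real.exp (-s / v)) i

lemma integral_vgauss_sub (M : ℕ) {v : ℝ} (hv : 0 < v) (c : Fin M → ℂ) :
    ∫ r : Fin M → ℂ, (vgauss M v (r - c) : ℂ) * 1 = 1 := by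
  simp only [mul_one]
  rw [integral_sub_right_eq_self (fun r : Fin M → ℂ => (vgauss M v r : ℂ)),
    integral_complex_ofReal, integral_vgauss M hv, Complex.ofReal_one]

lemma integral_vgauss_sub_mul_apply (M : ℕ) {v : ℝ} (hv : 0 < v) (c : Fin M → ℂ) (i : Fin M) :
    ∫ r : Fin M → ℂ, (vgauss M v (r - c) : ℂ) * r i = c i := by
  have h := integral_sub_right_eq_self
    (fun r : Fin M → ℂ => (vgauss M v r : ℂ) * (r i + c i)) (μ := volume) c
  simp only [Pi.sub_apply, sub_add_cancel] at h
  rw [h]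
  have i0 : Integrable fun r : Fin M → ℂ => (vgauss M v r : ℂ) := (integrable_vgauss M hv).ofReal
  simp_rw [mul_add]
  rw [integral_add (integrable_vgauss_mul M hv (by fun_prop) fun r => norm_le_one_add_nsq r i)
    (i0.mul_const _),
    integral_vgauss_mul_apply,
    integral_mul_const, integral_complex_ofReal, integral_vgauss M hv]
  simp

lemma integral_vgauss_sub_mul_outer (M : ℕ) {v : ℝ} (hv : 0 < v) (c : Fin M → ℂ)
    (i j : Fin M) :
    ∫ r : Fin M → ℂ, (vgauss M v (r - c) : ℂ) * (r i * star (r j)) =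
      c i * star (c j) + if i = j then (v : ℂ) else 0 := by
  have h := integral_sub_right_eq_self
    (fun r : Fin M → ℂ => (vgauss M v r : ℂ) * ((r i + c i) * star (r j + c j)))
    (μ := volume) c
  simp only [Pi.sub_apply, sub_add_cancel] at h
  rw [h]
  have hexp : ∀ r : Fin M → ℂ, (vgauss M v r : ℂ) * ((r i + c i) * star (r j + c j)) =
      ((vgauss M v r : ℂ) * (r i * star (r j)) + (vgauss M v r : ℂ) * r i * star (c j)) +
        (c i * star ((vgauss M v r : ℂ) * r j) + (vgauss M v r : ℂ) * (c i * star (c j))) := by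
    intro r
    have : star (vgauss M v r : ℂ) = (vgauss M v r : ℂ) := Complex.conj_ofReal _
    rw [star_add, star_mul', this]
    ring
  have i1 : ∀ k, Integrable fun r : Fin M → ℂ => (vgauss M v r : ℂ) * r k := fun k =>
    integrable_vgauss_mul M hv (by fun_prop) fun r => norm_le_one_add_nsq r k
  have i2 : Integrable fun r : Fin M → ℂ => (vgauss M v r : ℂ) * (r i * star (r j)) :=
    integrable_vgauss_mul M hv (by fun_prop) fun r =>
      (norm_mul_star_le_nsq r i j).trans (by linarith)
  have i0 : Integrable fun r : Fin M → ℂ => (vgauss M v r : ℂ) := (integrable_vgauss M hv).ofReal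
  have i3 : Integrable fun r : Fin M → ℂ => star ((vgauss M v r : ℂ) * r j) :=
    (LinearIsometryEquiv.integrable_comp_iff (Complex.conjLIE)).2 (i1 j)
  have z2 : ∫ r : Fin M → ℂ, star ((vgauss M v r : ℂ) * r j) = 0 := by
    have := integral_conj (μ := volume) (f := fun r : Fin M → ℂ => (vgauss M v r : ℂ) * r j)
    rw [integral_vgauss_mul_apply, map_zero] at this
    exact this
  simp_rw [hexp]
  rw [integral_add (by exact i2.add ((i1 i).mul_const _))
      (by exact (i3.const_mul _).add (i0.mul_const _)),
    integral_add i2 ((i1 i).mul_const _), integral_add (i3.const_mul _) (i0.mul_const _),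
    integral_mul_const, integral_const_mul, integral_mul_const, integral_vgauss_mul_apply, z2,
    integral_vgauss_mul_outer M hv, integral_complex_ofReal, integral_vgauss M hv]
  simp [add_comm]

lemma nsq_div_add_nsq_sub_div {M : ℕ} {u v : ℝ} (hu : 0 < u) (hv : 0 < v) (r x : Fin M → ℂ) :
    nsq r / u + nsq (x - r) / v =
      nsq x / (u + v) + nsq (r - (u / (u + v)) • x) / (u * v / (u + v)) := by
  simp only [nsq, Finset.sum_div, ← Finset.sum_add_distrib]
  refine Finset.sum_congr rfl fun i _ => ?_
  have : u + v ≠ 0 := by positivity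
  simp only [Complex.sq_norm, Complex.normSq_apply, Pi.sub_apply, Pi.smul_apply,
    Complex.sub_re, Complex.sub_im, Complex.real_smul, Complex.re_ofReal_mul,
    Complex.im_ofReal_mul]
  field_simp
  ring

lemma gaussian_mul_vgauss {M : ℕ} {u v : ℝ} (hu : 0 < u) (hv : 0 < v) (r x : Fin M → ℂ) :
    (u ^ M)⁻¹ * Real.exp (-nsq r / u) * vgauss M v (x - r) =
      ((u + v) ^ M)⁻¹ * Real.exp (-nsq x / (u + v)) *
        vgauss M (u * v / (u + v)) (r - (u / (u + v)) • x) := by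
  have hπ := Real.pi_pos
  have huv : 0 < u + v := by positivity
  have h1 : Real.exp (-nsq r / u) * Real.exp (-nsq (x - r) / v) =
      Real.exp (-nsq x / (u + v)) *
        Real.exp (-nsq (r - (u / (u + v)) • x) / (u * v / (u + v))) := by
    rw [← Real.exp_add, ← Real.exp_add]
    congr 1
    have := nsq_div_add_nsq_sub_div hu hv r x
    simp only [neg_div]
    linarith
  have h2 : (u ^ M)⁻¹ * ((Real.pi * v) ^ M)⁻¹ =
      ((u + v) ^ M)⁻¹ * ((Real.pi * (u * v / (u + v))) ^ M)⁻¹ := by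
    rw [← mul_inv, ← mul_inv, ← mul_pow, ← mul_pow]
    congr 2
    field_simp
  unfold vgauss
  calc _ = ((u ^ M)⁻¹ * ((Real.pi * v) ^ M)⁻¹) *
        (Real.exp (-nsq r / u) * Real.exp (-nsq (x - r) / v)) := by ring
    _ = _ := by rw [h1, h2]; ring

/-- A nonnegative weight on `(0, ∞)`, integrable also against `g ^ (-2M)`. -/
structure AdmissibleWeight (M : ℕ) (W : ℝ → ℝ) : Prop where
  measurable : Measurable W
  nonneg : ∀ g, 0 < g → 0 ≤ W g
  integrable : IntegrableOn W (Ioi 0)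
  integrable_div : IntegrableOn (fun g => W g / g ^ (2 * M)) (Ioi 0)

/-- The mixture integral `∫₀^∞ W(g) g^{2k} (g²+τ²)^{-n} exp(-s/(g²+τ²)) dg`. -/
def mixInt (W : ℝ → ℝ) (τ : ℝ) (k n : ℕ) (s : ℝ) : ℝ :=
  ∫ g in Ioi (0 : ℝ),
    W g * (g ^ 2) ^ k / (g ^ 2 + τ ^ 2) ^ n * Real.exp (-s / (g ^ 2 + τ ^ 2))

lemma measurable_mixInt {M : ℕ} {W : ℝ → ℝ} (hW : AdmissibleWeight M W) (τ : ℝ) (k n : ℕ) :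
    Measurable (mixInt W τ k n) := by
  have hWm := hW.measurable
  have h : StronglyMeasurable (Function.uncurry fun s g : ℝ =>
      W g * (g ^ 2) ^ k / (g ^ 2 + τ ^ 2) ^ n * Real.exp (-s / (g ^ 2 + τ ^ 2))) := by
    refine Measurable.stronglyMeasurable ?_
    unfold Function.uncurry
    fun_prop
  exact h.integral_prod_right.measurable

lemma integrableOn_mixInt {M : ℕ} {W : ℝ → ℝ} (hW : AdmissibleWeight M W) {τ : ℝ} (hτ : 0 < τ)
    {k n : ℕ} (hkn : k ≤ n) {s : ℝ} (hs : 0 ≤ s) :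
    IntegrableOn (fun g => W g * (g ^ 2) ^ k / (g ^ 2 + τ ^ 2) ^ n *
      Real.exp (-s / (g ^ 2 + τ ^ 2))) (Ioi 0) := by
  have hWm := hW.measurable
  refine (hW.integrable.mul_const ((τ ^ 2) ^ (n - k))⁻¹).mono'
    (by fun_prop) ?_
  filter_upwards [self_mem_ae_restrict measurableSet_Ioi] with g hg
  have hg0 : (0 : ℝ) < g := hg
  have hw := hW.nonneg g hg
  have hd : 0 < g ^ 2 + τ ^ 2 := by positivity
  rw [Real.norm_of_nonneg (by positivity), mul_div_assoc, mul_assoc]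
  refine mul_le_mul_of_nonneg_left ?_ hw
  have h1 : Real.exp (-s / (g ^ 2 + τ ^ 2)) ≤ 1 :=
    Real.exp_le_one_iff.2 (div_nonpos_of_nonpos_of_nonneg (by linarith) hd.le)
  have h2 : (g ^ 2) ^ k / (g ^ 2 + τ ^ 2) ^ n ≤ ((τ ^ 2) ^ (n - k))⁻¹ := by
    rw [div_le_iff₀ (by positivity), ← div_eq_inv_mul, le_div_iff₀ (by positivity)]
    calc (g ^ 2) ^ k * (τ ^ 2) ^ (n - k)
        ≤ (g ^ 2 + τ ^ 2) ^ k * (g ^ 2 + τ ^ 2) ^ (n - k) := by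
          gcongr <;> nlinarith [sq_nonneg g, sq_nonneg τ]
      _ = (g ^ 2 + τ ^ 2) ^ n := by rw [← pow_add, Nat.add_sub_cancel' hkn]
  calc _ ≤ ((τ ^ 2) ^ (n - k))⁻¹ * 1 := by gcongr
    _ = _ := mul_one _

lemma mixInt_nonneg {M : ℕ} {W : ℝ → ℝ} (hW : AdmissibleWeight M W) (τ : ℝ) (k n : ℕ) (s : ℝ) :
    0 ≤ mixInt W τ k n s := by
  refine setIntegral_nonneg measurableSet_Ioi fun g hg => ?_
  have := hW.nonneg g hg
  positivity

lemma mixInt_succ_succ {M : ℕ} {W : ℝ → ℝ} (hW : AdmissibleWeight M W) {τ : ℝ} (hτ : 0 < τ)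
    {k n : ℕ} (hkn : k ≤ n) {s : ℝ} (hs : 0 ≤ s) :
    mixInt W τ (k + 1) (n + 1) s = mixInt W τ k n s - τ ^ 2 * mixInt W τ k (n + 1) s := by
  unfold mixInt
  rw [← integral_const_mul, ← integral_sub (integrableOn_mixInt hW hτ hkn hs)
    ((integrableOn_mixInt hW hτ (by omega) hs).const_mul _)]
  refine integral_congr_ae (.of_forall fun g => ?_)
  have hd : g ^ 2 + τ ^ 2 ≠ 0 := by positivity
  simp only
  field_simp
  ring

lemma mixInt_sq_nonneg {M : ℕ} {W : ℝ → ℝ} (hW : AdmissibleWeight M W) {τ : ℝ} (hτ : 0 < τ)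
    {n : ℕ} {s : ℝ} (hs : 0 ≤ s) (t : ℝ) :
    0 ≤ mixInt W τ 2 (n + 2) s - 2 * t * mixInt W τ 1 (n + 1) s + t ^ 2 * mixInt W τ 0 n s := by
  have i2 := integrableOn_mixInt hW hτ (show 2 ≤ n + 2 by omega) hs
  have i1 := (integrableOn_mixInt hW hτ (show 1 ≤ n + 1 by omega) hs).const_mul (2 * t)
  have i0 := (integrableOn_mixInt hW hτ (show 0 ≤ n by omega) hs).const_mul (t ^ 2)
  unfold mixInt
  rw [← integral_const_mul, ← integral_const_mul, ← integral_sub i2 i1,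
    ← integral_add (by exact i2.sub i1) i0]
  refine setIntegral_nonneg measurableSet_Ioi fun g hg => ?_
  have hd : g ^ 2 + τ ^ 2 ≠ 0 := by positivity
  have := hW.nonneg g hg
  have h : W g * (g ^ 2) ^ 2 / (g ^ 2 + τ ^ 2) ^ (n + 2) * Real.exp (-s / (g ^ 2 + τ ^ 2)) -
      2 * t * (W g * (g ^ 2) ^ 1 / (g ^ 2 + τ ^ 2) ^ (n + 1) * Real.exp (-s / (g ^ 2 + τ ^ 2))) +
      t ^ 2 * (W g * (g ^ 2) ^ 0 / (g ^ 2 + τ ^ 2) ^ n * Real.exp (-s / (g ^ 2 + τ ^ 2))) =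
      W g / (g ^ 2 + τ ^ 2) ^ n * (g ^ 2 / (g ^ 2 + τ ^ 2) - t) ^ 2 *
        Real.exp (-s / (g ^ 2 + τ ^ 2)) := by
    field_simp
    ring
  rw [h]
  positivity

/-- Two-sided bound for the posterior variance of the shrinkage factor. -/
lemma abs_mixInt_variance_le {M : ℕ} {W : ℝ → ℝ} (hW : AdmissibleWeight M W) {τ : ℝ} (hτ : 0 < τ)
    {n : ℕ} {s P : ℝ} (hs : 0 ≤ s) (hP : 0 < P) :
    |mixInt W τ 2 (n + 2) s - mixInt W τ 1 (n + 1) s ^ 2 / (P + mixInt W τ 0 n s)| ≤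
      P + τ ^ 4 * mixInt W τ 0 (n + 2) s := by
  have hA := mixInt_nonneg hW τ 0 n s
  have hQ := mixInt_sq_nonneg hW hτ (n := n) hs (mixInt W τ 1 (n + 1) s / (P + mixInt W τ 0 n s))
  have e1 := mixInt_succ_succ hW hτ (show 0 ≤ n by omega) hs
  have e2 := mixInt_succ_succ hW hτ (show 1 ≤ n + 1 by omega) hs
  have e3 := mixInt_succ_succ hW hτ (show 0 ≤ n + 1 by omega) hs
  simp only [zero_add, one_add_one_eq_two, add_assoc] at e1 e2 e3
  set A := mixInt W τ 0 n s
  set N := mixInt W τ 1 (n + 1) s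
  set U := mixInt W τ 2 (n + 2) s
  set H := mixInt W τ 0 (n + 2) s
  set K := τ ^ 2 * mixInt W τ 0 (n + 1) s with hK
  have hX : 0 < P + A := by linarith
  have hU : U = N - K + τ ^ 4 * H := by
    rw [e2, e3]; ring
  have hlow : 0 ≤ U - N ^ 2 / (P + A) := by
    have h1 : N ^ 2 * A / (P + A) ^ 2 ≤ N ^ 2 / (P + A) := by
      rw [div_le_div_iff₀ (by positivity) hX]
      nlinarith [mul_nonneg (mul_nonneg (sq_nonneg N) hX.le) hP.le]
    have h2 : 2 * (N / (P + A)) * N = 2 * (N ^ 2 / (P + A)) := by ring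
    have h3 : (N / (P + A)) ^ 2 * A = N ^ 2 * A / (P + A) ^ 2 := by
      rw [div_pow]; ring
    linarith
  rw [abs_of_nonneg hlow, sub_le_iff_le_add]
  have h4 : U - P - τ ^ 4 * H ≤ N ^ 2 / (P + A) := by
    rw [le_div_iff₀ hX, hU, e1]
    nlinarith [sq_nonneg (K + P)]
  linarith

lemma integrable_vgauss_sub_mul {M : ℕ} {v : ℝ} (hv : 0 < v) {X : (Fin M → ℂ) → ℂ}
    (hX : Continuous X) (hXb : ∀ r, ‖X r‖ ≤ 1 + nsq r) (x : Fin M → ℂ) :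
    Integrable fun r : Fin M → ℂ => (vgauss M v (x - r) : ℂ) * X r := by
  have h : Integrable fun r : Fin M → ℂ => (vgauss M v r : ℂ) * X (x - r) := by
    have := continuous_vgauss M v
    refine ((integrable_one_add_nsq_mul_vgauss M hv).const_mul (2 + 2 * nsq x)).mono'
      (Continuous.aestronglyMeasurable (by fun_prop)) (.of_forall fun r => ?_)
    have hv0 := vgauss_nonneg M hv r
    rw [norm_mul, Complex.norm_real, Real.norm_of_nonneg hv0, mul_comm, ← mul_assoc]
    refine mul_le_mul_of_nonneg_right ((hXb _).trans ?_) hv0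
    have h1 : nsq (x - r) ≤ 2 * nsq x + 2 * nsq r := by
      simp only [nsq, Finset.mul_sum, ← Finset.sum_add_distrib]
      refine Finset.sum_le_sum fun i _ => ?_
      have h2 := norm_sub_le (x i) (r i)
      rw [Pi.sub_apply]
      nlinarith [norm_nonneg (x i - r i), sq_nonneg (‖x i‖ - ‖r i‖)]
    nlinarith [nsq_nonneg x, nsq_nonneg r, mul_nonneg (nsq_nonneg x) (nsq_nonneg r)]
  simpa using h.comp_sub_left x

/-- Posterior expectations under a Gaussian scale mixture are mixtures of the conditional
posterior expectations. -/
lemma integral_scaleMixture_mul {M : ℕ} {W : ℝ → ℝ} (hW : AdmissibleWeight M W) {τ : ℝ}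
    (hτ : 0 < τ) {q : (Fin M → ℂ) → ℝ} {A : ℝ}
    (hq : ∀ r, q r = A * ∫ g in Ioi (0 : ℝ), W g / g ^ (2 * M) * Real.exp (-nsq r / g ^ 2))
    {X : (Fin M → ℂ) → ℂ} (hX : Continuous X) (hXb : ∀ r, ‖X r‖ ≤ 1 + nsq r)
    (x : Fin M → ℂ) {Y : ℝ → ℂ}
    (hY : ∀ g, 0 < g → ∫ r, (vgauss M (g ^ 2 * τ ^ 2 / (g ^ 2 + τ ^ 2))
      (r - (g ^ 2 / (g ^ 2 + τ ^ 2)) • x) : ℂ) * X r = Y g) :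
    Integrable (fun r => ((q r * vgauss M (τ ^ 2) (x - r) : ℝ) : ℂ) * X r) ∧
    ∫ r, ((q r * vgauss M (τ ^ 2) (x - r) : ℝ) : ℂ) * X r =
      A * ∫ g in Ioi (0 : ℝ), ((W g / (g ^ 2 + τ ^ 2) ^ M *
        Real.exp (-nsq x / (g ^ 2 + τ ^ 2)) : ℝ) : ℂ) * Y g := by
  have hτ2 : 0 < τ ^ 2 := by positivity
  let f : (Fin M → ℂ) → ℝ → ℂ := fun r g =>
    ((W g / g ^ (2 * M) * Real.exp (-nsq r / g ^ 2) * vgauss M (τ ^ 2) (x - r) : ℝ) : ℂ) * X r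
  have hf : Integrable (Function.uncurry f)
      ((volume : Measure (Fin M → ℂ)).prod (volume.restrict (Ioi (0 : ℝ)))) := by
    refine ((integrable_vgauss_sub_mul hτ2 hX hXb x).norm.mul_prod
      hW.integrable_div.norm).mono' ?_ (.of_forall fun p => ?_)
    · have h1 := hW.measurable
      have h2 := (continuous_nsq (M := M)).measurable
      have h3 := (continuous_vgauss M (τ ^ 2)).measurable
      have h4 := hX.measurable
      refine Measurable.aestronglyMeasurable ?_
      unfold f Function.uncurry
      fun_prop
    · simp only [f, Function.uncurry, norm_mul, Complex.norm_real]
      have h1 : ‖Real.exp (-nsq p.1 / p.2 ^ 2)‖ ≤ 1 := by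
        rw [Real.norm_of_nonneg (Real.exp_nonneg _), Real.exp_le_one_iff]
        exact div_nonpos_of_nonpos_of_nonneg (by linarith [nsq_nonneg p.1]) (sq_nonneg _)
      calc _ ≤ ‖W p.2 / p.2 ^ (2 * M)‖ * 1 * ‖vgauss M (τ ^ 2) (x - p.1)‖ * ‖X p.1‖ := by gcongr
        _ = _ := by ring
  have hfr : ∀ r, ((q r * vgauss M (τ ^ 2) (x - r) : ℝ) : ℂ) * X r =
      A * ∫ g in Ioi (0 : ℝ), f r g := by
    intro r
    simp only [f]
    rw [integral_mul_const, integral_complex_ofReal, integral_mul_const, hq]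
    push_cast
    ring
  simp_rw [hfr]
  refine ⟨hf.integral_prod_left.const_mul _, ?_⟩
  rw [integral_const_mul, integral_integral_swap hf]
  congr 1
  refine setIntegral_congr_fun measurableSet_Ioi fun g hg => ?_
  have hg0 : (0 : ℝ) < g := hg
  rw [← hY g hg, ← integral_const_mul]
  refine integral_congr_ae (.of_forall fun r => ?_)
  have hk := gaussian_mul_vgauss (M := M) (pow_pos hg0 2) hτ2 r x
  simp only [f]
  rw [← mul_assoc, ← Complex.ofReal_mul]
  congr 2
  rw [pow_mul]
  linear_combination W g * hk

lemma integrable_mixture {M : ℕ} {h V : ℝ → ℝ} {τ : ℝ} (hτ : 0 < τ) (hh : Continuous h)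
    (hh0 : ∀ s, 0 ≤ s → 0 ≤ h s) (hV : Measurable V) (hV0 : ∀ g, 0 < g → 0 ≤ V g)
    (hG : ∀ v, 0 < v → Integrable fun r : Fin M → ℂ => h (nsq r) * Real.exp (-nsq r / v))
    (hI : IntegrableOn (fun g => V g * ∫ r : Fin M → ℂ, h (nsq r) *
      Real.exp (-nsq r / (g ^ 2 + τ ^ 2))) (Ioi 0)) :
    Integrable (Function.uncurry fun (r : Fin M → ℂ) g => V g * (h (nsq r) *
      Real.exp (-nsq r / (g ^ 2 + τ ^ 2)))) (volume.prod (volume.restrict (Ioi (0 : ℝ)))) := by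
  have h2 := (continuous_nsq (M := M)).measurable
  have h3 := hh.measurable
  rw [integrable_prod_iff']
  · refine ⟨.of_forall fun g => (hG (g ^ 2 + τ ^ 2) (by positivity)).const_mul (V g), hI.congr ?_⟩
    filter_upwards [self_mem_ae_restrict measurableSet_Ioi] with g hg
    rw [← integral_const_mul]
    refine integral_congr_ae (.of_forall fun r => ?_)
    have := hV0 g hg
    have := hh0 _ (nsq_nonneg r)
    simp only [Function.uncurry]
    rw [Real.norm_of_nonneg (by positivity)]
  · refine Measurable.aestronglyMeasurable ?_
    unfold Function.uncurry
    fun_prop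

lemma integral_matrix_apply {Ω : Type*} [MeasurableSpace Ω] {μ : Measure Ω} {M : ℕ}
    {f : Ω → Matrix (Fin M) (Fin M) ℂ} (hf : ∀ i j, Integrable (fun x => f x i j) μ)
    (i j : Fin M) : (∫ x, f x ∂μ) i j = ∫ x, f x i j ∂μ := by
  have h1 : ∀ i, Integrable (fun x => (f x i : Fin M → ℂ)) μ := fun i =>
    Integrable.of_eval (hf i)
  have h2 := eval_integral (f := fun x => (f x : Fin M → Fin M → ℂ)) h1 i
  have h3 := eval_integral (f := fun x => (f x i : Fin M → ℂ)) (hf i) j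
  rw [← h3, ← h2]
  rfl

lemma Qfun_nonneg (b c g : ℝ) : 0 ≤ Qfun b c g :=
  setIntegral_nonneg measurableSet_Ioi fun _ _ => (Real.exp_pos _).le

lemma integrable_exp_neg_sq : Integrable fun s : ℝ => Real.exp (-s ^ 2) := by
  simpa using integrable_exp_neg_mul_sq one_pos

lemma Qfun_le (b c g : ℝ) : Qfun b c g ≤ ∫ s : ℝ, Real.exp (-s ^ 2) :=
  setIntegral_le_integral integrable_exp_neg_sq (.of_forall fun _ => (Real.exp_pos _).le)

lemma measurable_Qfun (b c : ℝ) : Measurable (Qfun b c) := by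
  have h : Antitone fun x : ℝ => ∫ s in Ioi x, Real.exp (-s ^ 2) := fun x y hxy =>
    setIntegral_mono_set integrable_exp_neg_sq.integrableOn
      (.of_forall fun _ => (Real.exp_pos _).le) (Ioi_subset_Ioi hxy).eventuallyLE
  exact h.measurable.comp ((Real.measurable_log.const_mul b).add_const c)

lemma exists_Qfun_le_mul_rpow {b : ℝ} (hb : b < 0) (c : ℝ) {k : ℝ} (hk : 0 ≤ k) :
    ∃ C : ℝ, ∀ g, 0 < g → Qfun b c g ≤ C * g ^ k := by
  set t := -k / b with ht
  have ht0 : 0 ≤ t := div_nonneg_of_nonpos (by linarith) hb.le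
  have hi : Integrable fun s : ℝ => Real.exp (-(1 / 2) * s ^ 2) :=
    integrable_exp_neg_mul_sq (by norm_num)
  refine ⟨Real.exp (-t * c + t ^ 2 / 2) * ∫ s : ℝ, Real.exp (-(1 / 2) * s ^ 2), fun g hg => ?_⟩
  set x := b * Real.log g + c with hx
  have h1 : Qfun b c g ≤
      ∫ s in Ioi x, Real.exp (-t * x + t ^ 2 / 2) * Real.exp (-(1 / 2) * s ^ 2) := by
    refine setIntegral_mono_on integrable_exp_neg_sq.integrableOn
      (hi.const_mul _).integrableOn measurableSet_Ioi fun s hs => ?_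
    rw [← Real.exp_add, Real.exp_le_exp]
    have hs' : x < s := hs
    nlinarith [sq_nonneg (s - t), mul_nonneg ht0 (sub_nonneg.2 hs'.le)]
  have h2 : ∫ s in Ioi x, Real.exp (-(1 / 2) * s ^ 2) ≤ ∫ s : ℝ, Real.exp (-(1 / 2) * s ^ 2) :=
    setIntegral_le_integral hi (.of_forall fun _ => (Real.exp_pos _).le)
  have h3 : Real.exp (-t * x + t ^ 2 / 2) = Real.exp (-t * c + t ^ 2 / 2) * g ^ k := by
    rw [Real.rpow_def_of_pos hg, ← Real.exp_add]
    congr 1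
    have : t * b = -k := div_mul_cancel₀ _ hb.ne
    rw [hx]
    linear_combination (-Real.log g) * this
  rw [integral_const_mul] at h1
  calc Qfun b c g ≤ _ := h1
    _ ≤ Real.exp (-t * x + t ^ 2 / 2) * ∫ s : ℝ, Real.exp (-(1 / 2) * s ^ 2) := by gcongr
    _ = _ := by rw [h3]; ring

lemma integrableOn_rpow_mul_Qfun_div {b : ℝ} (hb : b < 0) (c : ℝ) {γ : ℝ} (hγ : 1 < γ) (n : ℕ) :
    IntegrableOn (fun g => g ^ (-γ) * Qfun b c g / g ^ n) (Ioi 0) := by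
  have hQ := measurable_Qfun b c
  have hm : Measurable fun g => g ^ (-γ) * Qfun b c g / g ^ n := by fun_prop
  rw [← Ioc_union_Ioi_eq_Ioi zero_le_one]
  refine IntegrableOn.union ?_ ?_
  · obtain ⟨C, hC⟩ := exists_Qfun_le_mul_rpow hb c (k := γ + n) (by positivity)
    refine (integrableOn_const (C := C) (by simp)).mono' hm.aestronglyMeasurable ?_
    filter_upwards [self_mem_ae_restrict measurableSet_Ioc] with g hg
    have hg0 : 0 < g := hg.1
    have := Qfun_nonneg b c g
    rw [Real.norm_of_nonneg (by positivity)]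
    have h1 : g ^ (-γ) * g ^ (γ + n) = g ^ n := by
      rw [← Real.rpow_add hg0, neg_add_cancel_left, Real.rpow_natCast]
    calc g ^ (-γ) * Qfun b c g / g ^ n ≤ g ^ (-γ) * (C * g ^ (γ + n)) / g ^ n := by
          gcongr; exact hC g hg0
      _ = C * (g ^ (-γ) * g ^ (γ + n)) / g ^ n := by ring
      _ = C := by rw [h1]; field_simp
  · refine ((integrableOn_Ioi_rpow_of_lt (a := -γ) (by linarith) one_pos).mul_const
      (∫ s : ℝ, Real.exp (-s ^ 2))).mono' hm.aestronglyMeasurable ?_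
    filter_upwards [self_mem_ae_restrict measurableSet_Ioi] with g hg
    have hg1 : 1 < g := hg
    have hg0 : 0 < g := one_pos.trans hg1
    have hQ0 := Qfun_nonneg b c g
    rw [Real.norm_of_nonneg (by positivity)]
    refine (div_le_self (by positivity) (one_le_pow₀ hg1.le)).trans ?_
    gcongr
    exact Qfun_le b c g

lemma admissibleWeight_rpow_mul_Qfun (M : ℕ) {b : ℝ} (hb : b < 0) (c : ℝ) {γ : ℝ} (hγ : 1 < γ) :
    AdmissibleWeight M fun g => g ^ (-γ) * Qfun b c g where
  measurable := by have := measurable_Qfun b c; fun_prop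
  nonneg g hg := by have := Qfun_nonneg b c g; positivity
  integrable := by simpa using integrableOn_rpow_mul_Qfun_div hb c hγ 0
  integrable_div := integrableOn_rpow_mul_Qfun_div hb c hγ (2 * M)

lemma qM_eq (a γ b c : ℝ) (M : ℕ) (r : Fin M → ℂ) :
    qM a γ b c M r = a / Real.pi ^ M * ∫ g in Ioi (0 : ℝ),
      g ^ (-γ) * Qfun b c g / g ^ (2 * M) * Real.exp (-nsq r / g ^ 2) := by
  unfold qM
  congr 1
  refine setIntegral_congr_fun measurableSet_Ioi fun g hg => ?_
  have hg0 : (0 : ℝ) < g := hg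
  have : (2 * (M : ℝ)) = ((2 * M : ℕ) : ℝ) := by push_cast; ring
  rw [this, Real.rpow_sub hg0, Real.rpow_natCast]
  ring

lemma xifun_eq (a γ b c τ lam : ℝ) (i : ℕ) (s : ℝ) :
    xifun a γ b c τ lam i s = (1 - lam) / (lam * a * τ ^ (2 * i)) * Real.exp (-s / τ ^ 2) +
      mixInt (fun g => g ^ (-γ) * Qfun b c g) τ 0 i s := by
  simp [xifun, mixInt]

lemma nufun_eq (γ b c τ : ℝ) (i : ℕ) (s : ℝ) :
    nufun γ b c τ i s = mixInt (fun g => g ^ (-γ) * Qfun b c g) τ 1 (i + 1) s := by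
  refine setIntegral_congr_fun measurableSet_Ioi fun g hg => ?_
  simp only
  rw [sub_eq_add_neg, Real.rpow_add hg, Real.rpow_two]
  ring

lemma mufun_eq (γ b c τ : ℝ) (i : ℕ) (s : ℝ) :
    mufun γ b c τ i s = mixInt (fun g => g ^ (-γ) * Qfun b c g) τ 2 (i + 2) s := by
  refine setIntegral_congr_fun measurableSet_Ioi fun g hg => ?_
  have h4 : (4 : ℝ) = ((4 : ℕ) : ℝ) := by norm_num
  simp only
  rw [sub_eq_add_neg, Real.rpow_add hg, h4, Real.rpow_natCast]
  ring

/-- The integrated conditional covariance given the scale. -/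
lemma integral_mixInt_one_nsq {M : ℕ} {W : ℝ → ℝ} (hW : AdmissibleWeight M W) {τ : ℝ}
    (hτ : 0 < τ) :
    Integrable (fun r : Fin M → ℂ => mixInt W τ 1 (M + 1) (nsq r)) ∧
    ∫ r : Fin M → ℂ, mixInt W τ 1 (M + 1) (nsq r) =
      Real.pi ^ M * ∫ g in Ioi (0 : ℝ), W g * g ^ 2 / (g ^ 2 + τ ^ 2) := by
  have hWm := hW.measurable
  let V : ℝ → ℝ := fun g => W g * g ^ 2 / (g ^ 2 + τ ^ 2) ^ (M + 1)
  have hval : ∀ g, V g * ∫ r : Fin M → ℂ, 1 * Real.exp (-nsq r / (g ^ 2 + τ ^ 2)) =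
      Real.pi ^ M * (W g * g ^ 2 / (g ^ 2 + τ ^ 2)) := by
    intro g
    have hd : 0 < g ^ 2 + τ ^ 2 := by positivity
    simp only [one_mul, V]
    rw [integral_nsq_gaussian hd, mul_pow]
    field_simp
    ring
  have hI := integrable_mixture (M := M) (h := fun _ => 1) (V := V) hτ continuous_const
    (fun _ _ => zero_le_one) (by fun_prop)
    (fun g hg => by have := hW.nonneg g hg; positivity)
    (fun v hv => by simpa using integrable_nsq_gaussian hv) (by
      simp_rw [hval]
      have := (integrableOn_mixInt hW hτ (le_refl 1) (le_refl 0)).const_mul (Real.pi ^ M)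
      simpa [IntegrableOn] using this)
  have hmix : ∀ r : Fin M → ℂ, mixInt W τ 1 (M + 1) (nsq r) =
      ∫ g in Ioi (0 : ℝ), V g * (1 * Real.exp (-nsq r / (g ^ 2 + τ ^ 2))) := fun r => by
    simp [mixInt, V]
  simp_rw [hmix]
  refine ⟨hI.integral_prod_left, ?_⟩
  rw [integral_integral_swap hI]
  simp_rw [integral_const_mul (V _), hval]
  rw [integral_const_mul]

lemma integrable_mixInt_zero_nsq_mul_nsq {M : ℕ} (hM : 1 ≤ M) {W : ℝ → ℝ}
    (hW : AdmissibleWeight M W) {τ : ℝ} (hτ : 0 < τ) :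
    Integrable (fun r : Fin M → ℂ => mixInt W τ 0 (M + 2) (nsq r) * nsq r) := by
  have hWm := hW.measurable
  let V : ℝ → ℝ := fun g => W g / (g ^ 2 + τ ^ 2) ^ (M + 2)
  have hval : ∀ g, V g * ∫ r : Fin M → ℂ, nsq r * Real.exp (-nsq r / (g ^ 2 + τ ^ 2)) =
      Real.pi ^ M / (M - 1).factorial * M.factorial * (W g / (g ^ 2 + τ ^ 2)) := by
    intro g
    have hd : 0 < g ^ 2 + τ ^ 2 := by positivity
    have h1 : ∀ s : ℝ, s ^ (M - 1) * (s * Real.exp (-s / (g ^ 2 + τ ^ 2))) =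
        s ^ M * Real.exp (-s / (g ^ 2 + τ ^ 2)) := by
      intro s
      rw [← mul_assoc, ← pow_succ, Nat.sub_add_cancel hM]
    rw [integral_comp_nsq hM fun s => s * Real.exp (-s / (g ^ 2 + τ ^ 2))]
    simp_rw [h1, V]
    rw [integral_pow_mul_exp_neg_div M hd]
    field_simp
    ring
  have hI := integrable_mixture (M := M) (h := fun s => s) (V := V) hτ continuous_id
    (fun _ hs => hs) (by fun_prop)
    (fun g hg => by have := hW.nonneg g hg; positivity)
    (fun v hv => by
      refine ((integrable_one_add_nsq_mul_gaussian (M := M) hv).sub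
        (integrable_nsq_gaussian hv)).congr (.of_forall fun r => ?_)
      simp only [Pi.sub_apply]
      ring) (by
      simp_rw [hval]
      have := (integrableOn_mixInt hW hτ (zero_le_one' ℕ) (le_refl 0)).const_mul
        (Real.pi ^ M / (M - 1).factorial * M.factorial)
      simpa [IntegrableOn] using this)
  refine hI.integral_prod_left.congr (.of_forall fun r => ?_)
  simp only [mixInt, V, Function.uncurry]
  rw [← integral_mul_const]
  refine integral_congr_ae (.of_forall fun g => ?_)
  simp only
  ring

section ScaleMixture

variable {M : ℕ} {W : ℝ → ℝ} {τ A : ℝ} {q : (Fin M → ℂ) → ℝ}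

lemma integral_scaleMixture (hW : AdmissibleWeight M W) (hτ : 0 < τ)
    (hq : ∀ r, q r = A * ∫ g in Ioi (0 : ℝ), W g / g ^ (2 * M) * Real.exp (-nsq r / g ^ 2))
    (x : Fin M → ℂ) :
    ∫ r, q r * vgauss M (τ ^ 2) (x - r) = A * mixInt W τ 0 M (nsq x) := by
  have h := (integral_scaleMixture_mul hW hτ hq (X := fun _ => 1) continuous_const
    (fun r => by simpa using nsq_nonneg r) x (Y := fun _ => 1)
    (fun g hg => integral_vgauss_sub M (by positivity) _)).2
  simp only [mul_one] at h
  rw [integral_complex_ofReal, integral_complex_ofReal] at h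
  have h' := Complex.ofReal_injective (h.trans (Complex.ofReal_mul _ _).symm)
  simpa [mixInt] using h'

lemma integral_scaleMixture_mul_apply (hW : AdmissibleWeight M W) (hτ : 0 < τ)
    (hq : ∀ r, q r = A * ∫ g in Ioi (0 : ℝ), W g / g ^ (2 * M) * Real.exp (-nsq r / g ^ 2))
    (x : Fin M → ℂ) (i : Fin M) :
    Integrable (fun r => ((q r * vgauss M (τ ^ 2) (x - r) : ℝ) : ℂ) * r i) ∧
    ∫ r, ((q r * vgauss M (τ ^ 2) (x - r) : ℝ) : ℂ) * r i =
      A * (mixInt W τ 1 (M + 1) (nsq x) * x i) := by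
  have h := integral_scaleMixture_mul hW hτ hq (X := fun r => r i) (by fun_prop)
    (fun r => norm_le_one_add_nsq r i) x
    (fun g hg => integral_vgauss_sub_mul_apply M (by positivity) _ i)
  refine ⟨h.1, h.2.trans ?_⟩
  rw [mixInt, ← integral_complex_ofReal, ← integral_mul_const]
  congr 1
  refine integral_congr_ae (.of_forall fun g => ?_)
  have hd : (g : ℂ) ^ 2 + (τ : ℂ) ^ 2 ≠ 0 := by
    have : g ^ 2 + τ ^ 2 ≠ 0 := by positivity
    exact_mod_cast this
  simp only [Pi.smul_apply, Complex.real_smul]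
  push_cast
  field_simp
  ring

lemma integral_scaleMixture_mul_outer (hW : AdmissibleWeight M W) (hτ : 0 < τ)
    (hq : ∀ r, q r = A * ∫ g in Ioi (0 : ℝ), W g / g ^ (2 * M) * Real.exp (-nsq r / g ^ 2))
    (x : Fin M → ℂ) (i j : Fin M) :
    Integrable (fun r => ((q r * vgauss M (τ ^ 2) (x - r) : ℝ) : ℂ) * (r i * star (r j))) ∧
    ∫ r, ((q r * vgauss M (τ ^ 2) (x - r) : ℝ) : ℂ) * (r i * star (r j)) =
      A * (mixInt W τ 2 (M + 2) (nsq x) * (x i * star (x j)) +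
        if i = j then ((τ ^ 2 * mixInt W τ 1 (M + 1) (nsq x) : ℝ) : ℂ) else 0) := by
  have h := integral_scaleMixture_mul hW hτ hq (X := fun r => r i * star (r j)) (by fun_prop)
    (fun r => (norm_mul_star_le_nsq r i j).trans (by linarith)) x
    (fun g hg => integral_vgauss_sub_mul_outer M (by positivity) _ i j)
  refine ⟨h.1, h.2.trans ?_⟩
  have i2 : IntegrableOn (fun g : ℝ => ((W g * (g ^ 2) ^ 2 / (g ^ 2 + τ ^ 2) ^ (M + 2) *
      Real.exp (-nsq x / (g ^ 2 + τ ^ 2)) : ℝ) : ℂ)) (Ioi 0) :=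
    (integrableOn_mixInt hW hτ (show 2 ≤ M + 2 by omega) (nsq_nonneg x)).ofReal
  have i1 : IntegrableOn (fun g : ℝ => ((W g * (g ^ 2) ^ 1 / (g ^ 2 + τ ^ 2) ^ (M + 1) *
      Real.exp (-nsq x / (g ^ 2 + τ ^ 2)) : ℝ) : ℂ)) (Ioi 0) :=
    (integrableOn_mixInt hW hτ (show 1 ≤ M + 1 by omega) (nsq_nonneg x)).ofReal
  have hite : (if i = j then ((τ ^ 2 * mixInt W τ 1 (M + 1) (nsq x) : ℝ) : ℂ) else 0) =
      (if i = j then (τ : ℂ) ^ 2 else 0) * (mixInt W τ 1 (M + 1) (nsq x) : ℂ) := by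
    split_ifs <;> simp
  rw [hite, mixInt, mixInt, ← integral_complex_ofReal, ← integral_complex_ofReal]
  congr 1
  rw [← integral_mul_const, ← integral_const_mul,
    ← integral_add (by exact i2.mul_const _) (by exact i1.const_mul _)]
  refine integral_congr_ae (.of_forall fun g => ?_)
  have hd : (g : ℂ) ^ 2 + (τ : ℂ) ^ 2 ≠ 0 := by
    have : g ^ 2 + τ ^ 2 ≠ 0 := by positivity
    exact_mod_cast this
  have hstar : star ((g ^ 2 / (g ^ 2 + τ ^ 2) : ℝ) : ℂ) = ((g ^ 2 / (g ^ 2 + τ ^ 2) : ℝ) : ℂ) :=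
    Complex.conj_ofReal _
  simp only [Pi.smul_apply, Complex.real_smul, star_mul', hstar]
  split_ifs
  · push_cast
    field_simp
    ring
  · push_cast
    field_simp
    ring

/-- The integral over `ℂ^M` of the posterior covariance, entry by entry. -/
lemma integral_posteriorCov_entry (hM : 1 ≤ M) (hW : AdmissibleWeight M W) (hτ : 0 < τ)
    {P : ℝ} (hP : 0 < P) (i j : Fin M) {D : ℝ → ℝ}
    (hD : ∀ s, D s = mixInt W τ 2 (M + 2) s - mixInt W τ 1 (M + 1) s ^ 2 /
      (P * Real.exp (-s / τ ^ 2) + mixInt W τ 0 M s)) :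
    Integrable (fun x : Fin M → ℂ => (D (nsq x) : ℂ) * (x i * star (x j)) +
      if i = j then ((τ ^ 2 * mixInt W τ 1 (M + 1) (nsq x) : ℝ) : ℂ) else 0) ∧
    ∫ x : Fin M → ℂ, ((D (nsq x) : ℂ) * (x i * star (x j)) +
      if i = j then ((τ ^ 2 * mixInt W τ 1 (M + 1) (nsq x) : ℝ) : ℂ) else 0) =
      if i = j then ((Real.pi ^ M * ((∫ g in Ioi (0 : ℝ), τ ^ 2 * (W g * g ^ 2 / (g ^ 2 + τ ^ 2))) +
        (∫ s in Ioi (0 : ℝ), s ^ M * D s) / M.factorial) : ℝ) : ℂ) else 0 := by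
  have hDm : Measurable D := by
    have h2 := measurable_mixInt hW τ 2 (M + 2)
    have h1 := measurable_mixInt hW τ 1 (M + 1)
    have h0 := measurable_mixInt hW τ 0 M
    rw [funext hD]
    fun_prop
  have hDi : Integrable fun x : Fin M → ℂ => D (nsq x) * nsq x := by
    have hg := (integrable_one_add_nsq_mul_gaussian (M := M) (pow_pos hτ 2)).sub
      (integrable_nsq_gaussian (pow_pos hτ 2))
    refine ((hg.const_mul P).add
      ((integrable_mixInt_zero_nsq_mul_nsq hM hW hτ).const_mul (τ ^ 4))).mono' ?_
      (.of_forall fun x => ?_)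
    · have := (continuous_nsq (M := M)).measurable
      exact ((hDm.comp this).mul this).aestronglyMeasurable
    · have hb := abs_mixInt_variance_le hW hτ (n := M) (nsq_nonneg x)
        (mul_pos hP (Real.exp_pos (-nsq x / τ ^ 2)))
      rw [← hD] at hb
      rw [norm_mul, Real.norm_of_nonneg (nsq_nonneg x), Real.norm_eq_abs]
      refine (mul_le_mul_of_nonneg_right hb (nsq_nonneg x)).trans (le_of_eq ?_)
      simp only [Pi.add_apply, Pi.sub_apply]
      ring
  have hT := integral_mixInt_one_nsq (M := M) hW hτ
  have hO := integrable_comp_nsq_mul_outer hDm hDi i j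
  have hOv := integral_comp_nsq_mul_outer hDm hDi i j
  by_cases hij : i = j
  · simp only [if_pos hij] at hOv ⊢
    have hTi : Integrable fun x : Fin M → ℂ =>
        ((τ ^ 2 * mixInt W τ 1 (M + 1) (nsq x) : ℝ) : ℂ) := (hT.1.const_mul (τ ^ 2)).ofReal
    refine ⟨hO.add hTi, ?_⟩
    rw [integral_add hO hTi, hOv, integral_complex_ofReal, integral_const_mul, hT.2,
      ← Complex.ofReal_add, integral_const_mul]
    congr 1
    ring
  · simp only [if_neg hij, add_zero] at hOv ⊢
    exact ⟨hO, hOv⟩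

end ScaleMixture

/-- with only statistical knowledge of the large-scale fading, the integrated
posterior covariance is `MSE · I_M` with the stated `MSE`. -/
theorem stmt14
    (M : ℕ) (hM : 1 ≤ M)
    (R α β σ : ℝ) (hR : 0 < R) (hβ : 0 < β) (hσ : 0 < σ)
    (γ a b c : ℝ)
    (hγ : γ = 40 / β + 1)
    (ha : a = 40 / (R ^ 2 * β * Real.sqrt Real.pi) *
      Real.exp (2 * (Real.log 10) ^ 2 * σ ^ 2 / β ^ 2 - 2 * (Real.log 10) * α / β))
    (hb : b = -10 * Real.sqrt 2 / ((Real.log 10) * σ))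
    (hc : c = (-α - β * Real.logb 10 R) / (Real.sqrt 2 * σ) - 20 / (β * b))
    (τ lam : ℝ) (hτ : 0 < τ) (hlam : lam ∈ Set.Ioo (0 : ℝ) 1)
    (m : (Fin M → ℂ) → ℝ)
    (Smat Bouter : (Fin M → ℂ) → Matrix (Fin M) (Fin M) ℂ)
    (B : (Fin M → ℂ) → (Fin M → ℂ))
    (hm : ∀ rt, m rt = (1 - lam) * vgauss M (τ ^ 2) rt +
      lam * ∫ r : Fin M → ℂ, qM a γ b c M r * vgauss M (τ ^ 2) (rt - r))
    (hSmat : ∀ rt, Smat rt =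
      lam • ∫ r : Fin M → ℂ,
        (qM a γ b c M r * vgauss M (τ ^ 2) (rt - r)) • Matrix.vecMulVec r (star r))
    (hB : ∀ rt, B rt =
      lam • ∫ r : Fin M → ℂ, (qM a γ b c M r * vgauss M (τ ^ 2) (rt - r)) • r)
    (hBouter : ∀ rt, Bouter rt = Matrix.vecMulVec (B rt) (star (B rt))) :
    ∫ rt : Fin M → ℂ, (Smat rt - (m rt)⁻¹ • Bouter rt) =
      ((∫ g in Set.Ioi (0 : ℝ), a * lam * g ^ (2 - γ) * τ ^ 2 * Qfun b c g / (g ^ 2 + τ ^ 2)) +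
        ∫ s in Set.Ioi (0 : ℝ),
          lam * a * s ^ M / Real.Gamma (M + 1) *
            (mufun γ b c τ M s - (nufun γ b c τ M s) ^ 2 / xifun a γ b c τ lam M s)) •
        (1 : Matrix (Fin M) (Fin M) ℂ) := by
  have hπ := Real.pi_pos
  obtain ⟨hl0, hl1⟩ := hlam
  have hγ1 : 1 < γ := by rw [hγ]; linarith [div_pos (show (0 : ℝ) < 40 by norm_num) hβ]
  have ha0 : 0 < a := by rw [ha]; positivity
  have hb0 : b < 0 := by
    have := Real.log_pos (show (1 : ℝ) < 10 by norm_num)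
    rw [hb]
    exact div_neg_of_neg_of_pos (by nlinarith [Real.sqrt_pos.2 (show (0 : ℝ) < 2 by norm_num)])
      (by positivity)
  set W : ℝ → ℝ := fun g => g ^ (-γ) * Qfun b c g with hWdef
  have hW : AdmissibleWeight M W := admissibleWeight_rpow_mul_Qfun M hb0 c hγ1
  have hq := qM_eq a γ b c M
  set P : ℝ := (1 - lam) / (lam * a * τ ^ (2 * M)) with hPdef
  have hP : 0 < P := div_pos (by linarith) (by positivity)
  set L : ℝ := lam * a / Real.pi ^ M with hL
  have hL0 : 0 < L := by positivity
  let D : ℝ → ℝ := fun s => mixInt W τ 2 (M + 2) s - mixInt W τ 1 (M + 1) s ^ 2 /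
      (P * Real.exp (-s / τ ^ 2) + mixInt W τ 0 M s)
  have hmx : ∀ x, m x = L * (P * Real.exp (-nsq x / τ ^ 2) + mixInt W τ 0 M (nsq x)) := by
    intro x
    rw [hm, integral_scaleMixture hW hτ hq, vgauss, hPdef, hL, mul_pow, ← pow_mul]
    field_simp
  have hBx : ∀ x i, B x i = L * (mixInt W τ 1 (M + 1) (nsq x) * x i) := by
    intro x i
    have h := fun k => integral_scaleMixture_mul_apply hW hτ hq x k
    have h1 := eval_integral (f := fun r : Fin M → ℂ =>
      (qM a γ b c M r * vgauss M (τ ^ 2) (x - r)) • r) (fun k => by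
        simpa only [Pi.smul_apply, Complex.real_smul] using (h k).1) i
    rw [hB, Pi.smul_apply, h1]
    simp only [Pi.smul_apply, Complex.real_smul]
    rw [(h i).2, hL]
    push_cast
    ring
  have hSx : ∀ x i j, Smat x i j = L * (mixInt W τ 2 (M + 2) (nsq x) * (x i * star (x j)) +
      if i = j then ((τ ^ 2 * mixInt W τ 1 (M + 1) (nsq x) : ℝ) : ℂ) else 0) := by
    intro x i j
    have h := fun k l => integral_scaleMixture_mul_outer hW hτ hq x k l
    have h1 := integral_matrix_apply (f := fun r : Fin M → ℂ =>
      (qM a γ b c M r * vgauss M (τ ^ 2) (x - r)) • Matrix.vecMulVec r (star r)) (fun k l => by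
        simpa only [Matrix.smul_apply, Matrix.vecMulVec_apply, Pi.star_apply,
          Complex.real_smul] using (h k l).1) i j
    rw [hSmat, Matrix.smul_apply, h1]
    simp only [Matrix.smul_apply, Matrix.vecMulVec_apply, Pi.star_apply, Complex.real_smul]
    rw [(h i j).2, hL]
    push_cast
    ring
  have hentry : ∀ x i j, (Smat x - (m x)⁻¹ • Bouter x) i j =
      L * ((D (nsq x) : ℂ) * (x i * star (x j)) +
        if i = j then ((τ ^ 2 * mixInt W τ 1 (M + 1) (nsq x) : ℝ) : ℂ) else 0) := by
    intro x i j
    have hξ : 0 < P * Real.exp (-nsq x / τ ^ 2) + mixInt W τ 0 M (nsq x) := by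
      have := mixInt_nonneg hW τ 0 M (nsq x)
      positivity
    rw [Matrix.sub_apply, Matrix.smul_apply, hBouter, Matrix.vecMulVec_apply, Pi.star_apply, hSx,
      hBx, hBx, hmx, Complex.real_smul]
    simp only [D]
    generalize P * Real.exp (-nsq x / τ ^ 2) + mixInt W τ 0 M (nsq x) = ξ at hξ
    have h1 : star (L : ℂ) = L := Complex.conj_ofReal _
    have h2 : star (mixInt W τ 1 (M + 1) (nsq x) : ℂ) = mixInt W τ 1 (M + 1) (nsq x) :=
      Complex.conj_ofReal _
    have hξ' : (ξ : ℂ) ≠ 0 := by exact_mod_cast hξ.ne'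
    have hL' : (L : ℂ) ≠ 0 := by exact_mod_cast hL0.ne'
    rw [star_mul', star_mul', h1, h2]
    push_cast
    field_simp
    ring
  have key := fun i j => integral_posteriorCov_entry hM hW hτ hP i j (D := D) fun _ => rfl
  ext i j
  rw [integral_matrix_apply (fun k l => by
    simp_rw [hentry]
    exact (key k l).1.const_mul _)]
  simp_rw [hentry]
  rw [integral_const_mul, (key i j).2, Matrix.smul_apply, Matrix.one_apply]
  by_cases hij : i = j
  · rw [if_pos hij, if_pos hij, Complex.real_smul, mul_one, ← Complex.ofReal_mul]
    congr 1
    have e1 : ∫ g in Ioi (0 : ℝ), a * lam * g ^ (2 - γ) * τ ^ 2 * Qfun b c g / (g ^ 2 + τ ^ 2) =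
        lam * a * ∫ g in Ioi (0 : ℝ), τ ^ 2 * (W g * g ^ 2 / (g ^ 2 + τ ^ 2)) := by
      rw [← integral_const_mul]
      refine setIntegral_congr_fun measurableSet_Ioi fun g hg => ?_
      simp only [hWdef]
      rw [sub_eq_add_neg, Real.rpow_add hg, Real.rpow_two]
      ring
    have e2 : ∫ s in Ioi (0 : ℝ), lam * a * s ^ M / Real.Gamma (M + 1) *
        (mufun γ b c τ M s - nufun γ b c τ M s ^ 2 / xifun a γ b c τ lam M s) =
        lam * a * ((∫ s in Ioi (0 : ℝ), s ^ M * D s) / M.factorial) := by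
      rw [← integral_div, ← integral_const_mul]
      refine integral_congr_ae (.of_forall fun s => ?_)
      simp only [mufun_eq, nufun_eq, xifun_eq, Real.Gamma_nat_eq_factorial, D, hWdef, hPdef]
      ring
    rw [e1, e2, hL]
    field_simp
  · rw [if_neg hij, if_neg hij, mul_zero, smul_zero]
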